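/- For every nonnegative integer n and real z, D_{−n−1}(z) = 2^{−1/2} √π ((−1)^n / n!) exp(−z^2/4) (d^n/dz^n)[ exp(z^2/2) · erfc(z/√2) ]. -/

import Mathlib

open Real MeasureTheory Filter Set

/-- Rising factorial (Pochhammer symbol) on ℝ. -/
noncomputable def pochhammerR (a : ℝ) : ℕ → ℝ
  | 0 => 1
  | n + 1 => pochhammerR a n * (a + n)

/-- Kummer's confluent hypergeometric function M(a,b,x) as a series. -/
noncomputable def kummerM (a b x : ℝ) : ℝ :=
  ∑' n : ℕ, (pochhammerR a n / pochhammerR b n) * x ^ n / (n.factorial : ℝ)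

/-- Parabolic cylinder function D_ν(z) (real order and argument), via the standard
representation in terms of confluent hypergeometric functions (DLMF 12.4). -/
noncomputable def cylD (ν z : ℝ) : ℝ :=
  (2 : ℝ) ^ (ν / 2) * Real.exp (-z ^ 2 / 4) * Real.sqrt π *
    (kummerM (-ν / 2) (1 / 2) (z ^ 2 / 2) / Real.Gamma ((1 - ν) / 2) -
      Real.sqrt 2 * z * kummerM ((1 - ν) / 2) (3 / 2) (z ^ 2 / 2) / Real.Gamma (-ν / 2))

/-- Complementary error function erfc(z) = (2/√π) ∫_z^∞ e^{-t²} dt. -/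
noncomputable def erfc (z : ℝ) : ℝ :=
  (2 / Real.sqrt π) * ∫ t in Set.Ioi z, Real.exp (-t ^ 2)

/-- The parabolic cylinder integral `∫₀^∞ tⁿ exp (-t² / 2 - y t) dt`. -/
noncomputable def cylIntegral (n : ℕ) (y : ℝ) : ℝ :=
  ∫ t in Ioi 0, t ^ n * exp (-t ^ 2 / 2 - y * t)

lemma integrableOn_pow_mul_exp_neg_sq_half_sub (n : ℕ) (y : ℝ) :
    IntegrableOn (fun t : ℝ => t ^ n * exp (-t ^ 2 / 2 - y * t)) (Ioi 0) := by
  have h := (integrableOn_rpow_mul_exp_neg_mul_sq (b := 1 / 4) (by norm_num) (s := n)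
    (by linarith [n.cast_nonneg (α := ℝ)])).const_mul (exp (y ^ 2))
  refine h.mono' (by fun_prop) ?_
  filter_upwards [ae_restrict_mem measurableSet_Ioi] with t ht
  have ht : 0 < t := ht
  rw [norm_of_nonneg (by positivity), rpow_natCast, mul_left_comm, ← exp_add]
  gcongr
  nlinarith [sq_nonneg (t / 2 + y)]

lemma hasDerivAt_cylIntegral (n : ℕ) (y : ℝ) :
    HasDerivAt (cylIntegral n) (-cylIntegral (n + 1) y) y := by
  have h := hasDerivAt_integral_of_dominated_loc_of_deriv_le
    (μ := volume.restrict (Ioi (0 : ℝ))) (x₀ := y)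
    (F := fun x t => t ^ n * exp (-t ^ 2 / 2 - x * t))
    (F' := fun x t => -(t ^ (n + 1) * exp (-t ^ 2 / 2 - x * t)))
    (bound := fun t => t ^ (n + 1) * exp (-t ^ 2 / 2 - (y - 1) * t))
    (Metric.ball_mem_nhds y one_pos)
    (.of_forall fun x => by fun_prop) (integrableOn_pow_mul_exp_neg_sq_half_sub n y)
    (by fun_prop) ?_ (integrableOn_pow_mul_exp_neg_sq_half_sub (n + 1) (y - 1)) ?_
  · rw [cylIntegral, ← integral_neg]
    exact h.2
  · filter_upwards [ae_restrict_mem measurableSet_Ioi] with t ht x hx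
    have ht : 0 < t := ht
    rw [Metric.mem_ball, dist_eq, abs_lt] at hx
    rw [norm_neg, norm_of_nonneg (by positivity)]
    gcongr
    linarith [hx.1]
  · refine .of_forall fun t x _ => ?_
    convert! ((((hasDerivAt_id x).mul_const t).const_sub (-t ^ 2 / 2)).exp.const_mul (t ^ n))
      using 1
    simp only [id]
    ring

lemma iteratedDeriv_cylIntegral (n : ℕ) :
    iteratedDeriv n (cylIntegral 0) = fun y => (-1) ^ n * cylIntegral n y := by
  induction n with
  | zero => simp
  | succ n ih =>
    ext y
    rw [iteratedDeriv_succ, ih, ((hasDerivAt_cylIntegral n y).const_mul _).deriv]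
    ring

lemma exp_mul_erfc_eq_cylIntegral (y : ℝ) :
    exp (y ^ 2 / 2) * erfc (y / √2) = √2 / √π * cylIntegral 0 y := by
  have hshift : ∫ t in Ioi y, exp (-t ^ 2 / 2) = ∫ s in Ioi 0, exp (-(s + y) ^ 2 / 2) := by
    have h := (measurePreserving_add_right volume y).setIntegral_preimage_emb
      (measurableEmbedding_addRight y) (fun t => exp (-t ^ 2 / 2)) (Ioi y)
    simpa using h.symm
  have hscale : ∫ t in Ioi (y / √2), exp (-t ^ 2) = (√2)⁻¹ * ∫ t in Ioi y, exp (-t ^ 2 / 2) := by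
    have h := integral_comp_mul_left_Ioi (fun t => exp (-t ^ 2 / 2)) (y / √2)
      (b := √2) (by positivity)
    rw [mul_div_cancel₀ _ (by positivity), smul_eq_mul] at h
    rw [← h]
    congr! 3 with t
    rw [mul_pow, sq_sqrt zero_le_two]
    ring
  have hexp : exp (y ^ 2 / 2) * ∫ s in Ioi 0, exp (-(s + y) ^ 2 / 2) = cylIntegral 0 y := by
    rw [cylIntegral, ← integral_const_mul]
    congr! 2 with t
    rw [← exp_add, pow_zero, one_mul]
    ring_nf
  rw [erfc, hscale, hshift, ← hexp]
  have h2 : (√2) ^ 2 = 2 := sq_sqrt zero_le_two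
  field_simp
  rw [h2]

lemma cylIntegral_zero_right (n : ℕ) :
    cylIntegral n 0 = 2 ^ (((n : ℝ) - 1) / 2) * Gamma (((n : ℝ) + 1) / 2) := by
  have h := integral_rpow_mul_exp_neg_mul_rpow (p := 2) (q := n) (b := 1 / 2) two_pos
    (by linarith [n.cast_nonneg (α := ℝ)]) (by norm_num)
  have hpow : ((1 : ℝ) / 2) ^ (-((n : ℝ) + 1) / 2) * (1 / 2) = 2 ^ (((n : ℝ) - 1) / 2) := by
    rw [one_div, inv_rpow zero_le_two, ← rpow_neg zero_le_two, ← rpow_neg_one 2,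
      ← rpow_add two_pos]
    ring_nf
  rw [hpow] at h
  rw [cylIntegral, ← h]
  congr! 2 with t
  rw [rpow_natCast, rpow_two]
  ring_nf

lemma hasSum_cylIntegral (n : ℕ) (z : ℝ) :
    HasSum (fun k : ℕ => (-z) ^ k / k.factorial * cylIntegral (n + k) 0) (cylIntegral n z) := by
  have hexp (t x : ℝ) : HasSum
      (fun k : ℕ => x ^ k / k.factorial * (t ^ (n + k) * exp (-t ^ 2 / 2 - 0 * t)))
      (t ^ n * exp (-t ^ 2 / 2 - (-x) * t)) := by
    have h := (NormedSpace.expSeries_div_hasSum_exp (x * t)).mul_left (t ^ n * exp (-t ^ 2 / 2))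
    rw [← exp_eq_exp_ℝ, mul_assoc, ← exp_add] at h
    convert! h using 1
    · ext k
      rw [zero_mul, sub_zero]
      ring
    · ring_nf
  have h := hasSum_integral_of_dominated_convergence (μ := volume.restrict (Ioi (0 : ℝ)))
    (F := fun (k : ℕ) t => (-z) ^ k / k.factorial * (t ^ (n + k) * exp (-t ^ 2 / 2 - 0 * t)))
    (f := fun t => t ^ n * exp (-t ^ 2 / 2 - z * t))
    (fun (k : ℕ) t => |z| ^ k / k.factorial * (t ^ (n + k) * exp (-t ^ 2 / 2 - 0 * t)))
    (fun k => by fun_prop) (fun k => ?_) (.of_forall fun t => (hexp t |z|).summable) ?_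
    (.of_forall fun t => by simpa using hexp t (-z))
  · simpa only [integral_const_mul] using! h
  · filter_upwards [ae_restrict_mem measurableSet_Ioi] with t ht
    have ht : 0 < t := ht
    rw [norm_mul, norm_of_nonneg (r := t ^ (n + k) * _) (by positivity)]
    simp
  · simp_rw [(hexp _ |z|).tsum_eq]
    exact integrableOn_pow_mul_exp_neg_sq_half_sub n (-|z|)

lemma Gamma_add_natCast_eq_pochhammerR_mul {a : ℝ} (ha : 0 < a) (m : ℕ) :
    Gamma (a + m) = pochhammerR a m * Gamma a := by
  induction m with
  | zero => simp [pochhammerR]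
  | succ m ih =>
    rw [Nat.cast_succ, ← add_assoc, Gamma_add_one (by positivity), ih, pochhammerR]
    ring

lemma factorial_two_mul_eq_pochhammerR (m : ℕ) :
    ((2 * m).factorial : ℝ) = 4 ^ m * m.factorial * pochhammerR (1 / 2) m := by
  induction m with
  | zero => simp [pochhammerR]
  | succ m ih =>
    rw [Nat.mul_succ, Nat.factorial_succ, Nat.factorial_succ, Nat.factorial_succ, pochhammerR]
    push_cast
    rw [ih]
    ring

lemma factorial_two_mul_add_one_eq_pochhammerR (m : ℕ) :
    ((2 * m + 1).factorial : ℝ) = 4 ^ m * m.factorial * pochhammerR (3 / 2) m := by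
  induction m with
  | zero => simp [pochhammerR]
  | succ m ih =>
    rw [Nat.mul_succ, Nat.factorial_succ, Nat.factorial_succ (2 * m + 1), Nat.factorial_succ m,
      pochhammerR]
    push_cast
    rw [ih]
    ring

lemma pochhammerR_pos {a : ℝ} (ha : 0 < a) (m : ℕ) : 0 < pochhammerR a m := by
  induction m with
  | zero => exact one_pos
  | succ m ih => exact mul_pos ih (by positivity)

lemma cylIntegral_add_two_mul_zero_right (n m : ℕ) :
    cylIntegral (n + 2 * m) 0 = 2 ^ m * pochhammerR (((n : ℝ) + 1) / 2) m * cylIntegral n 0 := by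
  have hpow : (2 : ℝ) ^ ((((n + 2 * m : ℕ) : ℝ) - 1) / 2) = 2 ^ m * 2 ^ (((n : ℝ) - 1) / 2) := by
    rw [← rpow_natCast 2 m, ← rpow_add two_pos]
    push_cast
    ring_nf
  rw [cylIntegral_zero_right, cylIntegral_zero_right, hpow,
    show (((n + 2 * m : ℕ) : ℝ) + 1) / 2 = ((n : ℝ) + 1) / 2 + m by push_cast; ring,
    Gamma_add_natCast_eq_pochhammerR_mul (by positivity)]
  ring

lemma cylIntegral_even_term (n m : ℕ) (z : ℝ) :
    (-z) ^ (2 * m) / (2 * m).factorial * cylIntegral (n + 2 * m) 0 =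
    cylIntegral n 0 * (pochhammerR (((n : ℝ) + 1) / 2) m / pochhammerR (1 / 2) m *
      (z ^ 2 / 2) ^ m / m.factorial) := by
  have := (pochhammerR_pos (a := 1 / 2) (by norm_num) m).ne'
  rw [cylIntegral_add_two_mul_zero_right, factorial_two_mul_eq_pochhammerR, pow_mul, neg_sq,
    div_pow, show (4 : ℝ) = 2 * 2 by norm_num, mul_pow]
  field_simp

lemma cylIntegral_odd_term (n m : ℕ) (z : ℝ) :
    (-z) ^ (2 * m + 1) / (2 * m + 1).factorial * cylIntegral (n + (2 * m + 1)) 0 =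
    -z * cylIntegral (n + 1) 0 * (pochhammerR (((n : ℝ) + 2) / 2) m / pochhammerR (3 / 2) m *
      (z ^ 2 / 2) ^ m / m.factorial) := by
  have := (pochhammerR_pos (a := 3 / 2) (by norm_num) m).ne'
  rw [← add_assoc, add_right_comm, cylIntegral_add_two_mul_zero_right,
    factorial_two_mul_add_one_eq_pochhammerR, pow_succ, pow_mul, neg_sq,
    div_pow, show (4 : ℝ) = 2 * 2 by norm_num, mul_pow,
    show (((n + 1 : ℕ) : ℝ) + 1) / 2 = ((n : ℝ) + 2) / 2 by push_cast; ring]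
  field_simp

lemma hasSum_nat_eq_tsum_even_add_tsum_odd {f : ℕ → ℝ} {s : ℝ} (h : HasSum f s) :
    s = (∑' m, f (2 * m)) + ∑' m, f (2 * m + 1) := by
  have h_even : Summable fun m => f (2 * m) :=
    h.summable.comp_injective (i := (2 * ·)) fun a b hab => by simpa using hab
  have h_odd : Summable fun m => f (2 * m + 1) :=
    h.summable.comp_injective (i := (2 * · + 1)) fun a b hab => by simpa using hab
  rw [tsum_even_add_odd h_even h_odd, h.tsum_eq]

lemma cylIntegral_eq_kummerM (n : ℕ) (z : ℝ) :
    cylIntegral n z = cylIntegral n 0 * kummerM (((n : ℝ) + 1) / 2) (1 / 2) (z ^ 2 / 2) -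
      z * cylIntegral (n + 1) 0 * kummerM (((n : ℝ) + 2) / 2) (3 / 2) (z ^ 2 / 2) := by
  rw [hasSum_nat_eq_tsum_even_add_tsum_odd (hasSum_cylIntegral n z),
    tsum_congr (cylIntegral_even_term n · z), tsum_congr (cylIntegral_odd_term n · z),
    tsum_mul_left, tsum_mul_left, kummerM, kummerM]
  ring

lemma cylD_eq_cylIntegral (n : ℕ) (z : ℝ) :
    cylD (-(n : ℝ) - 1) z = exp (-z ^ 2 / 4) / n.factorial * cylIntegral n z := by
  have hG : Gamma (((n : ℝ) + 1) / 2) * Gamma (((n : ℝ) + 2) / 2) * 2 ^ n =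
      n.factorial * √π := by
    have h := Gamma_mul_Gamma_add_half (((n : ℝ) + 1) / 2)
    rw [show ((n : ℝ) + 1) / 2 + 1 / 2 = ((n : ℝ) + 2) / 2 by ring,
      show 2 * (((n : ℝ) + 1) / 2) = n + 1 by ring, Gamma_nat_eq_factorial,
      show 1 - ((n : ℝ) + 1) = -n by ring, rpow_neg zero_le_two, rpow_natCast] at h
    rw [h]
    field_simp
  have hA : 0 < Gamma (((n : ℝ) + 1) / 2) := Gamma_pos_of_pos (by positivity)
  have hB : 0 < Gamma (((n : ℝ) + 2) / 2) := Gamma_pos_of_pos (by positivity)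
  have hpow : (2 : ℝ) ^ (((n : ℝ) - 1) / 2) = 2 ^ n * 2 ^ ((-(n : ℝ) - 1) / 2) := by
    rw [← rpow_natCast, ← rpow_add two_pos]
    ring_nf
  have hpow' : (2 : ℝ) ^ ((((n + 1 : ℕ) : ℝ) - 1) / 2) =
      2 ^ n * 2 ^ ((-(n : ℝ) - 1) / 2) * √2 := by
    rw [← rpow_natCast, ← rpow_add two_pos, sqrt_eq_rpow, ← rpow_add two_pos]
    push_cast
    ring_nf
  rw [cylIntegral_eq_kummerM, cylIntegral_zero_right, cylIntegral_zero_right, hpow, hpow', cylD,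
    show -(-(n : ℝ) - 1) / 2 = ((n : ℝ) + 1) / 2 by ring,
    show (1 - (-(n : ℝ) - 1)) / 2 = ((n : ℝ) + 2) / 2 by ring,
    show (((n + 1 : ℕ) : ℝ) + 1) / 2 = ((n : ℝ) + 2) / 2 by push_cast; ring]
  have hpi : √π = Gamma (((n : ℝ) + 1) / 2) * Gamma (((n : ℝ) + 2) / 2) * 2 ^ n / n.factorial := by
    rw [hG]
    field_simp
  rw [hpi]
  field_simp

theorem cylD_neg_int_order (n : ℕ) (z : ℝ) :
    cylD (-(n : ℝ) - 1) z =
      (2 : ℝ) ^ (-(1 : ℝ) / 2) * Real.sqrt π * ((-1 : ℝ) ^ n / (n.factorial : ℝ)) *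
        Real.exp (-z ^ 2 / 4) *
        iteratedDeriv n (fun y => Real.exp (y ^ 2 / 2) * erfc (y / Real.sqrt 2)) z := by
  have h2 : (2 : ℝ) ^ (-(1 : ℝ) / 2) = (√2)⁻¹ := by
    rw [sqrt_eq_rpow, ← rpow_neg zero_le_two, neg_div]
  have hsign : (-1 : ℝ) ^ n * (-1) ^ n = 1 := by rw [← mul_pow]; simp
  simp_rw [exp_mul_erfc_eq_cylIntegral]
  rw [iteratedDeriv_const_mul_field, iteratedDeriv_cylIntegral, cylD_eq_cylIntegral, h2]
  field_simp
  linear_combination (-cylIntegral n z) * hsign
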